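/- arXiv:1407.0514 — 2 statements merged into one kernel-verified Lean document; each statement's English description precedes it below -/
import Mathlib

section
/- Let p be a prime and let a be an integer with 1 < a < p. Then the sequence (r_0, r_1, r_2) = (p², p(p − a), p³ + p(a − 1) − 1) satisfies: d_1 = gcd(r_0) = p², d_2 = gcd(r_0, r_1) = p, d_3 = gcd(r_0, r_1, r_2) = 1; it is a characteristic sequence (i.e. d_1 > d_2 > d_3 = 1 and d_1 r_1 < d_2 r_2); it satisfies the conductor formula (d_1/d_2 − 1) r_1 + (d_2/d_3 − 1) r_2 = (r_0 − 1)²; but it violates the Abhyankar–Moh inequality, i.e. d_2 r_2 ≥ r_0². -/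
/-- For `p` prime and `1 < a < p`, the sequence
`(r 0, r 1, r 2) = (p², p(p-a), p³ + p(a-1) - 1)` has `d 1 = p²`, `d 2 = p`,
`d 3 = 1`, is a characteristic sequence, satisfies the conductor formula, but
violates the Abhyankar–Moh inequality `d 2 * r 2 < r 0 ^ 2`. -/
theorem stmt_14 (p a : ℕ) (hp : p.Prime) (ha1 : 1 < a) (hap : a < p) :
    Nat.gcd (p ^ 2) (p * (p - a)) = p ∧
    Nat.gcd (Nat.gcd (p ^ 2) (p * (p - a))) (p ^ 3 + p * (a - 1) - 1) = 1 ∧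
    -- axiom (1): d₁ > d₂ > d₃ = 1
    p < p ^ 2 ∧ 1 < p ∧
    -- axiom (2): d₁ r₁ < d₂ r₂
    p ^ 2 * (p * (p - a)) < p * (p ^ 3 + p * (a - 1) - 1) ∧
    -- conductor formula (4)
    (p ^ 2 / p - 1) * (p * (p - a)) + (p / 1 - 1) * (p ^ 3 + p * (a - 1) - 1)
      = (p ^ 2 - 1) ^ 2 ∧
    -- violation of the Abhyankar–Moh inequality (3)
    (p ^ 2) ^ 2 ≤ p * (p ^ 3 + p * (a - 1) - 1) := by
  have hp1 : 1 < p := hp.one_lt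
  have hp0 : 0 < p := hp.pos
  obtain ⟨c, hc⟩ : ∃ c, p - a = c := ⟨_, rfl⟩
  obtain ⟨b, hb⟩ : ∃ b, a - 1 = b := ⟨_, rfl⟩
  obtain ⟨r, hr⟩ : ∃ r, p ^ 3 + p * (a - 1) - 1 = r := ⟨_, rfl⟩
  rw [hr, hc]
  rw [hb] at hr
  have hpb : 1 ≤ p * b := Nat.mul_pos hp0 (by omega)
  have hr1 : r + 1 = p ^ 3 + p * b := by omega
  have hpr : p ^ 3 ≤ r := by omega
  have hpc : p = b + 1 + c := by omega
  have hgcd : Nat.gcd (p ^ 2) (p * c) = p := by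
    have hcop : Nat.Coprime p c :=
      (Nat.coprime_of_lt_prime (by omega) (by omega) hp)
    rw [sq, Nat.gcd_mul_left, hcop.gcd_eq_one, mul_one]
  have hAM : (p ^ 2) ^ 2 ≤ p * r := by
    calc (p ^ 2) ^ 2 = p * p ^ 3 := by ring
      _ ≤ p * r := Nat.mul_le_mul_left p hpr
  refine ⟨hgcd, ?_, by nlinarith, hp1, ?_, ?_, hAM⟩
  · rw [hgcd]
    refine (Nat.Prime.coprime_iff_not_dvd hp).2 fun hdvd => hp.one_lt.ne' ?_
    have hsum : p ∣ r + 1 := hr1 ▸ ⟨p ^ 2 + b, by ring⟩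
    exact Nat.dvd_one.1 ((Nat.dvd_add_right hdvd).1 hsum)
  · refine lt_of_lt_of_le ?_ hAM
    calc p ^ 2 * (p * c) < p ^ 2 * (p * p) := by
          gcongr
          omega
      _ = (p ^ 2) ^ 2 := by ring
  · have hdiv : p ^ 2 / p = p := by rw [sq, Nat.mul_div_cancel _ hp0]
    have hsq : 1 ≤ p ^ 2 := Nat.one_le_pow _ _ hp0
    rw [hdiv, Nat.div_one]
    zify [hp1.le, hsq] at hr1 hpc ⊢
    linear_combination ((p : ℤ) - 1) * hr1 - ((p : ℤ) - 1) * p * hpc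
end

section
/- Let p be a prime and let a be an integer with a > p and gcd(a, p) = 1. Then the sequence (r_0, r_1, r_2) = (ap, p(a − p), a²p + p(a − 1) − 1) satisfies: d_1 = gcd(r_0) = ap, d_2 = gcd(r_0, r_1) = p, d_3 = gcd(r_0, r_1, r_2) = 1; it is a characteristic sequence (i.e. d_1 > d_2 > d_3 = 1 and d_1 r_1 < d_2 r_2); it satisfies the conductor formula (d_1/d_2 − 1) r_1 + (d_2/d_3 − 1) r_2 = (r_0 − 1)²; but it violates the Abhyankar–Moh inequality, i.e. d_2 r_2 ≥ r_0². -/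
/-- For `p` prime and `a > p` coprime with `p`, the sequence
`(r 0, r 1, r 2) = (ap, p(a-p), a²p + p(a-1) - 1)` has `d 1 = ap`, `d 2 = p`,
`d 3 = 1`, is a characteristic sequence, satisfies the conductor formula, but
violates the Abhyankar–Moh inequality `d 2 * r 2 < r 0 ^ 2`. -/
theorem stmt_15 (p a : ℕ) (hp : p.Prime) (hpa : p < a) (hcop : Nat.gcd a p = 1) :
    Nat.gcd (a * p) (p * (a - p)) = p ∧
    Nat.gcd (Nat.gcd (a * p) (p * (a - p))) (a ^ 2 * p + p * (a - 1) - 1) = 1 ∧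
    -- axiom (1): d₁ > d₂ > d₃ = 1
    p < a * p ∧ 1 < p ∧
    -- axiom (2): d₁ r₁ < d₂ r₂
    (a * p) * (p * (a - p)) < p * (a ^ 2 * p + p * (a - 1) - 1) ∧
    -- conductor formula (4)
    ((a * p) / p - 1) * (p * (a - p)) + (p / 1 - 1) * (a ^ 2 * p + p * (a - 1) - 1)
      = (a * p - 1) ^ 2 ∧
    -- violation of the Abhyankar–Moh inequality (3)
    (a * p) ^ 2 ≤ p * (a ^ 2 * p + p * (a - 1) - 1) := by
  have hp1 : 1 < p := hp.one_lt
  have hgcd : Nat.gcd (a * p) (p * (a - p)) = p := by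
    rw [mul_comm a p, Nat.gcd_mul_left, Nat.gcd_self_sub_right hpa.le, hcop, mul_one]
  have hdiv : a * p / p = a := Nat.mul_div_cancel a hp.pos
  rw [hgcd, hdiv, Nat.div_one]
  obtain ⟨k, rfl⟩ := Nat.exists_eq_add_of_lt hpa
  obtain ⟨q, rfl⟩ := Nat.exists_eq_add_of_lt hp1
  set p := 1 + q + 1 with hpq
  have hk : p + k + 1 - p = k + 1 := by omega
  have hr : 1 ≤ p * (p + k) := Nat.mul_pos (by omega) (by omega)
  obtain ⟨r, hr'⟩ : ∃ r, p * (p + k) = r + 1 := ⟨p * (p + k) - 1, by omega⟩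
  have hr₂ : (p + k + 1) ^ 2 * p + p * (p + k + 1 - 1) - 1 = (p + k + 1) ^ 2 * p + r := by
    rw [Nat.add_sub_cancel, hr']
    omega
  have hap : (p + k + 1) * p - 1 = r + p := by
    have : (p + k + 1) * p = p * (p + k) + p := by ring
    omega
  have hp_sub : p - 1 = q + 1 := by omega
  rw [hk, hr₂, hap, Nat.add_sub_cancel, hp_sub]
  refine ⟨rfl, ?_, ?_, hp1, ?_, ?_, ?_⟩
  · have h : (p + k + 1) ^ 2 * p + r + 1 = p * ((p + k + 1) ^ 2 + (p + k)) := by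
      rw [add_assoc, ← hr']
      ring
    have hd : Nat.gcd p ((p + k + 1) ^ 2 * p + r) ∣ 1 := by
      refine (Nat.dvd_add_right (Nat.gcd_dvd_right p ((p + k + 1) ^ 2 * p + r))).mp ?_
      rw [h]
      exact (Nat.gcd_dvd_left _ _).mul_right _
    exact Nat.dvd_one.mp hd
  · nlinarith
  · rw [mul_comm (p + k + 1) p, mul_assoc]
    refine Nat.mul_lt_mul_of_pos_left ?_ hp.pos
    nlinarith [mul_pos hp.pos hp.pos, mul_pos (mul_pos hp.pos hp.pos) hp.pos]
  · zify at hr' hpq ⊢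
    have hq : (q : ℤ) = p - 2 := by linarith
    have hrz : (r : ℤ) = p * (p + k) - 1 := by linarith
    rw [hq, hrz]
    ring
  · nlinarith [Nat.zero_le (p * r)]
end
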